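/- arXiv:1801.08195 — 2 statements merged into one kernel-verified Lean document; each statement's English description precedes it below -/
import Mathlib

section
/- Let p1, p2, p3 be three distinct linear primes of height 2 in R, and let K = K1 ∩ p2 ∩ p3, where K1 is a p1-primary ideal with e(R/K1) = 2. If either K = I^un or K = L, then ht(p1 + p2 + p3) ≤ 5. -/
open MvPolynomial Filter CategoryTheory

noncomputable section

/-- The height of an ideal `J`: the infimum of the heights of the prime ideals containing it. -/
def idealHeight {R : Type} [CommRing R] (J : Ideal R) : ℕ∞ :=
  ⨅ p ∈ {p : {q : Ideal R // q.IsPrime} | J ≤ p.1}, Order.height p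

/-- `pdQuotLE J n` holds iff `R ⧸ J` admits a projective resolution of length at most `n`,
i.e. the projective dimension of `R ⧸ J` as an `R`-module is at most `n`. -/
def pdQuotLE {R : Type} [CommRing R] (J : Ideal R) (n : ℕ) : Prop :=
  ∃ P : ProjectiveResolution (ModuleCat.of R (R ⧸ J)),
    ∀ i, n < i → Limits.IsZero (P.complex.X i)

/-- The `p`-primary component of `J` for `p` a minimal prime of `J`:
the saturation of `J` at `p`. -/
def primaryComponent {R : Type} [CommRing R] (J p : Ideal R) : Ideal R :=
  ⨆ (s : R) (_ : s ∉ p), Submodule.colon J (Ideal.span {s})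

/-- The unmixed part `J^un` of `J`: the intersection of the primary components of `J`
corresponding to the minimal primes of `J` of minimal height. -/
def unmixedPart {R : Type} [CommRing R] (J : Ideal R) : Ideal R :=
  ⨅ p ∈ {p : Ideal R | p.IsPrime ∧ J ≤ p ∧ idealHeight p = idealHeight J},
    primaryComponent J p

/-- A linear prime: a prime ideal generated by forms of degree one. -/
def IsLinearPrime {k : Type} [CommSemiring k] {N : ℕ} (p : Ideal (MvPolynomial (Fin N) k)) : Prop :=
  p.IsPrime ∧ ∃ S : Set (MvPolynomial (Fin N) k), (∀ ℓ ∈ S, ℓ.IsHomogeneous 1) ∧ p = Ideal.span S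

/-- A homogeneous ideal: an ideal generated by homogeneous elements. -/
def IsHomogeneousIdeal {k : Type} [CommSemiring k] {N : ℕ}
    (J : Ideal (MvPolynomial (Fin N) k)) : Prop :=
  ∃ S : Set (MvPolynomial (Fin N) k), (∀ g ∈ S, ∃ d, g.IsHomogeneous d) ∧ J = Ideal.span S

/-- `[B]_n`: the ideal generated by all forms of degree `n` belonging to `B`. -/
def degreePart {k : Type} [CommSemiring k] {N : ℕ} (B : Ideal (MvPolynomial (Fin N) k)) (n : ℕ) :
    Ideal (MvPolynomial (Fin N) k) :=
  Ideal.span {f | f ∈ B ∧ f.IsHomogeneous n}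

/-- The Hilbert–Samuel function of `R/J` with respect to the irrelevant maximal ideal:
`n ↦ length (R / (J + 𝔪^n)) = dim_k (R / (J + 𝔪^n))`. -/
def hilbertSamuelFn {k : Type} [Field k] {N : ℕ} (J : Ideal (MvPolynomial (Fin N) k))
    (n : ℕ) : ℕ :=
  Module.finrank k
    (MvPolynomial (Fin N) k ⧸
      (J ⊔ (Ideal.span (Set.range (MvPolynomial.X : Fin N → MvPolynomial (Fin N) k))) ^ n))

/-- `HasMultiplicity J d e`: the quotient `R/J` has Krull dimension `d` and Hilbert–Samuel
multiplicity `e`, expressed through the asymptotics `d! · HS_J(n) / n^d → e` of the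
Hilbert–Samuel function. -/
def HasMultiplicity {k : Type} [Field k] {N : ℕ} (J : Ideal (MvPolynomial (Fin N) k))
    (d e : ℕ) : Prop :=
  Tendsto (fun n : ℕ => (Nat.factorial d : ℝ) * (hilbertSamuelFn J n : ℝ) / (n : ℝ) ^ d)
    atTop (nhds (e : ℝ))

/-- An ideal of `R` is extended from a subalgebra `A` if it is generated by elements of `A`. -/
def extendedFrom {k R : Type} [CommRing k] [CommRing R] [Algebra k R]
    (K : Ideal R) (A : Subalgebra k R) : Prop :=
  ∃ S : Set R, S ⊆ (A : Set R) ∧ K = Ideal.span S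

section Helpers

open scoped Classical in
/-- Kill the variables in `s`. -/
def killVars {k : Type} [Field k] {N : ℕ} (s : Set (Fin N)) :
    MvPolynomial (Fin N) k →ₐ[k] MvPolynomial (Fin N) k :=
  aeval (fun i => if i ∈ s then 0 else X i)

lemma sub_killVars_mem {k : Type} [Field k] {N : ℕ} (s : Set (Fin N))
    (f : MvPolynomial (Fin N) k) :
    f - killVars s f ∈ Ideal.span (X '' s : Set (MvPolynomial (Fin N) k)) := by
  rw [← Ideal.Quotient.eq]
  have : (Ideal.Quotient.mkₐ k (Ideal.span (X '' s : Set (MvPolynomial (Fin N) k)))) =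
      (Ideal.Quotient.mkₐ k (Ideal.span (X '' s : Set (MvPolynomial (Fin N) k)))).comp
        (killVars s) := by
    ext i
    simp only [killVars, AlgHom.comp_apply, aeval_X]
    split_ifs with h
    · rw [map_zero]
      exact Ideal.Quotient.eq_zero_iff_mem.mpr (Ideal.subset_span ⟨i, h, rfl⟩)
    · rfl
  exact DFunLike.congr_fun this f

lemma span_X_image_eq_ker {k : Type} [Field k] {N : ℕ} (s : Set (Fin N)) :
    Ideal.span (X '' s : Set (MvPolynomial (Fin N) k)) =
      RingHom.ker (killVars (k := k) s).toRingHom := by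
  apply le_antisymm
  · rw [Ideal.span_le]
    rintro _ ⟨i, hi, rfl⟩
    simp [killVars, RingHom.mem_ker, hi]
  · intro f hf
    have h := sub_killVars_mem s f
    have h0 : killVars s f = 0 := hf
    rwa [h0, sub_zero] at h

lemma isPrime_span_X_image {k : Type} [Field k] {N : ℕ} (s : Set (Fin N)) :
    (Ideal.span (X '' s : Set (MvPolynomial (Fin N) k))).IsPrime := by
  rw [span_X_image_eq_ker]
  exact RingHom.ker_isPrime _

lemma X_mem_span_X_image {k : Type} [Field k] {N : ℕ} (s : Set (Fin N)) (i : Fin N) :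
    (X i : MvPolynomial (Fin N) k) ∈ Ideal.span (X '' s : Set (MvPolynomial (Fin N) k)) ↔
      i ∈ s := by
  rw [span_X_image_eq_ker, RingHom.mem_ker]
  constructor
  · intro h
    by_contra hi
    have : killVars (k := k) s (X i) = 0 := h
    simp [killVars, hi] at this
  · intro hi
    change killVars (k := k) s (X i) = 0
    simp [killVars, hi]

/-- idealHeight agrees with Mathlib's height -/
lemma idealHeight_eq {R : Type} [CommRing R] (J : Ideal R) : idealHeight J = J.height := by
  have key : ∀ p : {q : Ideal R // q.IsPrime}, Order.height p = p.1.height := by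
    intro p
    have h := PrimeSpectrum.height_eq_orderHeight (⟨p.1, p.2⟩ : PrimeSpectrum R)
    rw [h]
    let e : {q : Ideal R // q.IsPrime} ≃o PrimeSpectrum R :=
      { toFun := fun q => ⟨q.1, q.2⟩
        invFun := fun q => ⟨q.asIdeal, q.isPrime⟩
        left_inv := fun _ => rfl
        right_inv := fun _ => rfl
        map_rel_iff' := Iff.rfl }
    exact (Order.height_orderIso e p).symm
  apply le_antisymm
  · rw [Ideal.height_eq_inf_minimalPrimes]
    refine le_iInf₂ fun q hq => ?_
    refine (iInf₂_le (⟨q, hq.1.1⟩ : {q : Ideal R // q.IsPrime}) hq.1.2).trans ?_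
    rw [key]
  · refine le_iInf₂ fun q hq => ?_
    rw [key]
    exact Ideal.height_mono hq

/-- A linear change of coordinates. -/
lemma exists_linear_equiv {k : Type} [Field k] {N d : ℕ} (l : Fin d → MvPolynomial (Fin N) k)
    (hl : ∀ i, (l i).IsHomogeneous 1) (hli : LinearIndependent k l) :
    ∃ (φ : MvPolynomial (Fin N) k ≃ₐ[k] MvPolynomial (Fin N) k) (e : Fin d → Fin N),
      Function.Injective e ∧ (∀ i, φ (X (e i)) = l i) ∧
      (∀ n f, f.IsHomogeneous n → (φ f).IsHomogeneous n) ∧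
      (∀ n f, f.IsHomogeneous n → (φ.symm f).IsHomogeneous n) := by
  let W := homogeneousSubmodule (Fin N) k 1
  have hXli : LinearIndependent k (X : Fin N → MvPolynomial (Fin N) k) :=
    MvPolynomial.linearIndependent_X _ _
  have hWspan : W = Submodule.span k (Set.range X) := homogeneousSubmodule_one_eq_span_X
  let bX : Module.Basis (Fin N) k W :=
    (Module.Basis.span hXli).map (LinearEquiv.ofEq _ _ hWspan.symm)
  have hbX : ∀ i, (bX i : MvPolynomial (Fin N) k) = X i := by
    intro i
    simp [bX, Module.Basis.span_apply]
  let l' : Fin d → W := fun i => ⟨l i, hl i⟩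
  have hl' : LinearIndependent k l' := by
    apply LinearIndependent.of_comp W.subtype
    exact hli
  let b0 := Module.Basis.sumExtend hl'
  let σ := b0.indexEquiv bX
  let b := b0.reindex σ
  let e : Fin d → Fin N := fun i => σ (Sum.inl i)
  have hb : ∀ i, b (e i) = l' i := by
    intro i
    simp [b, e, b0, Module.Basis.sumExtend]
    rfl
  let T : W →ₗ[k] MvPolynomial (Fin N) k := b.constr k (fun i => (X i : MvPolynomial (Fin N) k))
  have hT : ∀ i, T (b i) = X i := fun i => b.constr_basis _ _ _
  have hThom : ∀ w, (T w).IsHomogeneous 1 := by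
    intro w
    change T w ∈ W
    have : T w = ∑ i, b.repr w i • X i := by
      simp [T, Module.Basis.constr_apply_fintype]
    rw [this]
    exact Submodule.sum_mem _ fun i _ => Submodule.smul_mem _ _ (isHomogeneous_X _ _)
  let F : MvPolynomial (Fin N) k →ₐ[k] MvPolynomial (Fin N) k := aeval fun i => (b i).1
  let G : MvPolynomial (Fin N) k →ₐ[k] MvPolynomial (Fin N) k := aeval fun i => T (bX i)
  have hG : ∀ w : W, G w.1 = T w := by
    have : G.toLinearMap ∘ₗ W.subtype = T := by
      apply bX.ext
      intro i
      simp [hbX, G]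
    intro w
    exact DFunLike.congr_fun this w
  have hFT : ∀ w : W, F (T w) = w.1 := by
    have : F.toLinearMap ∘ₗ T = W.subtype := by
      apply b.ext
      intro i
      simp [hT, F]
    intro w
    exact DFunLike.congr_fun this w
  let φ : MvPolynomial (Fin N) k ≃ₐ[k] MvPolynomial (Fin N) k := AlgEquiv.ofAlgHom F G
    (by ext1 i; simp [G, hFT, hbX]) (by ext1 i; simp [F, hG, hT])
  refine ⟨φ, e, ?_, ?_, ?_, ?_⟩
  · intro i j hij
    exact Sum.inl_injective (σ.injective hij)
  · intro i
    change F (X (e i)) = l i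
    simp [F, hb, l']
  · intro n f hf
    change (F f).IsHomogeneous n
    have := hf.aeval (fun i => (b i).1) (fun i => (b i).2)
    rwa [one_mul] at this
  · intro n f hf
    change (G f).IsHomogeneous n
    have := hf.aeval (fun i => T (bX i)) (fun i => hThom _)
    rwa [one_mul] at this
lemma three_le_height {k : Type} [Field k] {N : ℕ} (l : Fin 3 → MvPolynomial (Fin N) k)
    (hl : ∀ i, (l i).IsHomogeneous 1) (hli : LinearIndependent k l)
    (p : Ideal (MvPolynomial (Fin N) k)) [hp : p.IsPrime] (hlp : ∀ i, l i ∈ p) :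
    3 ≤ p.height := by
  obtain ⟨φ, e, he, hφ, -, -⟩ := exists_linear_equiv l hl hli
  let Q : ℕ → Ideal (MvPolynomial (Fin N) k) := fun j =>
    (Ideal.span (X '' (e '' {i | i.val < j}) : Set (MvPolynomial (Fin N) k))).comap φ.symm
  have hQ : ∀ j, (Q j).IsPrime := by
    intro j
    have := isPrime_span_X_image (k := k) (e '' {i | i.val < j})
    exact Ideal.comap_isPrime _ _
  have hmem : ∀ j (i : Fin 3), l i ∈ Q j ↔ i.val < j := by
    intro j i
    simp only [Q, Ideal.mem_comap]
    rw [← hφ i, AlgEquiv.symm_apply_apply, X_mem_span_X_image]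
    simp [he.eq_iff]
  have hlt : ∀ j, j < 3 → Q j < Q (j + 1) := by
    intro j hj
    refine lt_of_le_of_ne ?_ ?_
    · apply Ideal.comap_mono
      apply Ideal.span_mono
      apply Set.image_mono
      apply Set.image_mono
      intro i hi
      exact Nat.lt_succ_of_lt hi
    · intro h
      have h1 := (hmem (j + 1) ⟨j, hj⟩).2 (Nat.lt_succ_self j)
      rw [← h] at h1
      exact absurd ((hmem j ⟨j, hj⟩).1 h1) (lt_irrefl _)
  have hle : Q 3 ≤ p := by
    intro f hf
    have h1 : φ.symm f ∈ Ideal.span (X '' (e '' {i | i.val < 3}) : Set (MvPolynomial (Fin N) k)) :=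
      hf
    have h2 : Ideal.span (X '' (e '' {i | i.val < 3}) : Set (MvPolynomial (Fin N) k)) ≤
        p.comap φ := by
      rw [Ideal.span_le]
      rintro _ ⟨_, ⟨i, -, rfl⟩, rfl⟩
      change φ (X (e i)) ∈ p
      rw [hφ]
      exact hlp i
    have h3 : φ (φ.symm f) ∈ p := h2 h1
    rwa [AlgEquiv.apply_symm_apply] at h3
  have hh : ∀ j : ℕ, j ≤ 3 → (j : ℕ∞) ≤ (Q j).height := by
    intro j
    induction j with
    | zero => simp
    | succ j ih =>
      intro hj
      have := hQ j
      have := hQ (j + 1)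
      have h1 := Ideal.height_add_one_le_of_lt_of_isPrime (hlt j (by omega))
      push_cast
      exact (add_le_add_left (ih (by omega)) 1).trans h1
  exact (hh 3 le_rfl).trans (Ideal.height_mono hle)

lemma span_basis {k : Type} [Field k] {N n : ℕ} (S : Set (MvPolynomial (Fin N) k))
    (b : Module.Basis (Fin n) k (Submodule.span k S)) :
    Ideal.span S = Ideal.span (Set.range fun i => (b i : MvPolynomial (Fin N) k)) := by
  apply le_antisymm
  · rw [Ideal.span_le]
    intro f hf
    have h1 : f = ∑ i, (b.repr ⟨f, Submodule.subset_span hf⟩ i) • (b i).1 := by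
      have := congrArg (Submodule.subtype _) (b.sum_repr ⟨f, Submodule.subset_span hf⟩)
      rw [map_sum] at this
      exact this.symm
    rw [h1]
    refine Submodule.sum_mem _ fun i _ => ?_
    exact Submodule.smul_of_tower_mem _ _ (Ideal.subset_span ⟨i, rfl⟩)
  · rw [Ideal.span_le]
    rintro _ ⟨i, rfl⟩
    exact Submodule.span_le_restrictScalars k (MvPolynomial (Fin N) k) S (b i).2

lemma height_span_le {k : Type} [Field k] {N n : ℕ} (S : Set (MvPolynomial (Fin N) k))
    (hfin : FiniteDimensional k (Submodule.span k S))
    (hn : Module.finrank k (Submodule.span k S) ≤ n) (hS : Ideal.span S ≠ ⊤) :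
    (Ideal.span S).height ≤ n := by
  let b := Module.finBasis k (Submodule.span k S)
  have h := span_basis S b
  refine (Ideal.height_le_spanFinrank _ hS).trans ?_
  rw [h]
  have h1 := Submodule.spanFinrank_span_le_ncard_of_finite (R := MvPolynomial (Fin N) k)
    (Set.finite_range fun i => (b i : MvPolynomial (Fin N) k))
  have h2 : (Set.range fun i => (b i : MvPolynomial (Fin N) k)).ncard ≤
      Module.finrank k (Submodule.span k S) := by
    rw [← Set.image_univ]
    refine (Set.ncard_image_le).trans ?_
    simp
  exact_mod_cast (h1.trans h2).trans hn

lemma linear_prime_gens {k : Type} [Field k] {N : ℕ} (p : Ideal (MvPolynomial (Fin N) k))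
    (hp : IsLinearPrime p) (hht : idealHeight p = 2) :
    ∃ a b : MvPolynomial (Fin N) k, a.IsHomogeneous 1 ∧ b.IsHomogeneous 1 ∧
      p = Ideal.span {a, b} := by
  rw [idealHeight_eq] at hht
  obtain ⟨hprime, S, hS, hpS⟩ := hp
  have hVle : Submodule.span k S ≤ homogeneousSubmodule (Fin N) k 1 :=
    Submodule.span_le.2 hS
  have hWfin : FiniteDimensional k (homogeneousSubmodule (Fin N) k 1) :=
    Module.Finite.iff_fg.2 (homogeneousSubmodule_fg _ _ 1)
  have hVfin : FiniteDimensional k (Submodule.span k S) :=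
    Submodule.finiteDimensional_of_le hVle
  have hVp : ∀ v ∈ Submodule.span k S, v ∈ p := by
    intro v hv
    rw [hpS]
    exact Submodule.span_le_restrictScalars k (MvPolynomial (Fin N) k) S hv
  have h2 : Module.finrank k (Submodule.span k S) = 2 := by
    apply le_antisymm
    · by_contra hcon
      push Not at hcon
      let b := Module.finBasis k (Submodule.span k S)
      have hli : LinearIndependent k
          (fun i : Fin 3 => (b (Fin.castLE hcon i) : MvPolynomial (Fin N) k)) := by
        have h1 := b.linearIndependent.map' (Submodule.span k S).subtype (Submodule.ker_subtype _)
        exact h1.comp _ (Fin.castLE_injective hcon)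
      have := three_le_height _ (fun i => hVle (b (Fin.castLE hcon i)).2) hli p
        (fun i => hVp _ (b (Fin.castLE hcon i)).2)
      rw [hht] at this
      exact absurd this (by decide)
    · by_contra hcon
      push Not at hcon
      have h3 := height_span_le (n := 1) S hVfin (by omega) (hpS ▸ hprime.ne_top)
      rw [← hpS, hht] at h3
      exact absurd h3 (by decide)
  let b := Module.finBasisOfFinrankEq k (Submodule.span k S) h2
  refine ⟨b 0, b 1, hVle (b 0).2, hVle (b 1).2, ?_⟩
  have h4 := span_basis S b
  rw [hpS, h4]
  congr 1
  ext x
  simp [eq_comm]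

lemma six_forms {k : Type} [Field k] {N : ℕ} (l : Fin 6 → MvPolynomial (Fin N) k)
    (hl : ∀ i, (l i).IsHomogeneous 1)
    (hht : ¬ idealHeight (Ideal.span (Set.range l)) ≤ 5) : LinearIndependent k l := by
  rw [idealHeight_eq] at hht
  by_contra hcon
  apply hht
  have hne : Ideal.span (Set.range l) ≠ ⊤ := by
    have hle : Ideal.span (Set.range l) ≤
        RingHom.ker (constantCoeff (σ := Fin N) (R := k)) := by
      rw [Ideal.span_le]
      rintro _ ⟨i, rfl⟩
      change constantCoeff (l i) = 0
      rw [constantCoeff_eq]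
      exact (hl i).coeff_eq_zero (by simp)
    intro htop
    have h1 : (1 : MvPolynomial (Fin N) k) ∈ Ideal.span (Set.range l) := by
      rw [htop]
      trivial
    have h2 : constantCoeff (1 : MvPolynomial (Fin N) k) = (0 : k) := hle h1
    simp at h2
  rw [linearIndependent_iff_card_le_finrank_span] at hcon
  simp only [Fintype.card_fin, Set.finrank, not_le] at hcon
  have hfd : FiniteDimensional k (Submodule.span k (Set.range l)) :=
    FiniteDimensional.span_of_finite k (Set.finite_range l)
  exact height_span_le (n := 5) (Set.range l) hfd (by omega) hne

lemma hs_bound {k : Type} [Field k] {N : ℕ} (p : Ideal (MvPolynomial (Fin N) k))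
    (φ : MvPolynomial (Fin N) k ≃ₐ[k] MvPolynomial (Fin N) k)
    (hφ : ∀ n f, f.IsHomogeneous n → (φ f).IsHomogeneous n)
    (e₀ e₁ : Fin N) (hne : e₀ ≠ e₁) (h₀ : φ (X e₀) ∈ p) (h₁ : φ (X e₁) ∈ p) (n : ℕ) :
    hilbertSamuelFn p (n + 1) ≤ ((N - 1) + n - 1).choose n := by
  classical
  unfold hilbertSamuelFn
  set J := p ⊔ (Ideal.span (Set.range (X : Fin N → MvPolynomial (Fin N) k))) ^ (n + 1) with hJ
  let A := Finset.finsuppAntidiag (Finset.univ.erase e₀ : Finset (Fin N)) n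
  let g : A → MvPolynomial (Fin N) k ⧸ J := fun t =>
    Ideal.Quotient.mk J (φ (monomial (t.1.erase e₁) 1))
  have hmon : ∀ s : Fin N →₀ ℕ, Ideal.Quotient.mk J (φ (monomial s 1)) ∈
      Submodule.span k (Set.range g) := by
    intro s
    by_cases hs0 : s e₀ = 0
    · by_cases hs1 : s e₁ = 0
      · by_cases hd : s.degree ≤ n
        · apply Submodule.subset_span
          refine ⟨⟨s + Finsupp.single e₁ (n - s.degree), ?_⟩, ?_⟩
          · rw [Finset.mem_finsuppAntidiag]
            constructor
            · have h1 : ∑ i ∈ Finset.univ.erase e₀, s i = s.degree := by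
                rw [Finsupp.degree_eq_sum, ← Finset.add_sum_erase _ _ (Finset.mem_univ e₀), hs0,
                  zero_add]
              simp only [Finsupp.coe_add, Pi.add_apply, Finset.sum_add_distrib]
              rw [h1, Finset.sum_eq_single e₁]
              · simp; omega
              · intro b _ hb
                simp [Finsupp.single_apply, hb.symm]
              · intro h
                exact absurd (Finset.mem_erase.2 ⟨hne.symm, Finset.mem_univ _⟩) h
            · intro i hi
              rw [Finset.mem_erase]
              refine ⟨?_, Finset.mem_univ _⟩
              rintro rfl
              simp [hs0, Finsupp.single_apply, hne.symm] at hi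
          · have : (s + Finsupp.single e₁ (n - s.degree)).erase e₁ = s := by
              ext i
              by_cases hi : i = e₁
              · subst hi; simp [hs1]
              · simp [Finsupp.erase_ne hi, Finsupp.single_apply, Ne.symm hi]
            simp only [g, this]
        · have hmem : φ (monomial s 1) ∈ J := by
            apply Ideal.mem_sup_right
            have h1 := hφ _ _ (isHomogeneous_monomial (1 : k) (rfl : s.degree = s.degree))
            change _ ∈ idealOfVars (Fin N) k ^ (n + 1)
            rw [mem_pow_idealOfVars_iff]
            intro x hx
            have h2 := h1.degree_eq_sum_deg_support hx
            have h3 : x.degree = s.degree := by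
              by_contra hc
              exact (mem_support_iff.1 hx) (h1.coeff_eq_zero hc)
            omega
          rw [Ideal.Quotient.eq_zero_iff_mem.2 hmem]
          exact Submodule.zero_mem _
      · have hmem : φ (monomial s 1) ∈ J := by
          apply Ideal.mem_sup_left
          obtain ⟨q, hq⟩ : (X e₁ : MvPolynomial (Fin N) k) ∣ monomial s 1 :=
            X_dvd_monomial.2 (Or.inr hs1)
          rw [hq, map_mul]
          exact Ideal.mul_mem_right _ _ h₁
        rw [Ideal.Quotient.eq_zero_iff_mem.2 hmem]
        exact Submodule.zero_mem _
    · have hmem : φ (monomial s 1) ∈ J := by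
        apply Ideal.mem_sup_left
        obtain ⟨q, hq⟩ : (X e₀ : MvPolynomial (Fin N) k) ∣ monomial s 1 :=
          X_dvd_monomial.2 (Or.inr hs0)
        rw [hq, map_mul]
        exact Ideal.mul_mem_right _ _ h₀
      rw [Ideal.Quotient.eq_zero_iff_mem.2 hmem]
      exact Submodule.zero_mem _
  have htop : Submodule.span k (Set.range g) = ⊤ := by
    rw [eq_top_iff]
    rintro x -
    obtain ⟨y, rfl⟩ := Ideal.Quotient.mk_surjective x
    obtain ⟨q, rfl⟩ := φ.surjective y
    let ψ : MvPolynomial (Fin N) k →ₗ[k] MvPolynomial (Fin N) k ⧸ J :=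
      (Ideal.Quotient.mkₐ k J).toLinearMap ∘ₗ φ.toLinearMap
    change ψ q ∈ _
    rw [q.as_sum, map_sum]
    refine Submodule.sum_mem _ fun s _ => ?_
    have : monomial s (coeff s q) = coeff s q • monomial s (1 : k) := by
      rw [smul_monomial, smul_eq_mul, mul_one]
    rw [this, map_smul]
    exact Submodule.smul_mem _ _ (hmon s)
  have hcard := finrank_range_le_card (R := k) g
  rw [Set.finrank, htop, finrank_top] at hcard
  refine hcard.trans ?_
  rw [Fintype.card_coe, Finset.card_finsuppAntidiag_nat_eq_choose, Finset.card_erase_of_mem (Finset.mem_univ _)]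
  simp

lemma not_mult_two {k : Type} [Field k] {N : ℕ} (hN : 2 ≤ N) (p : Ideal (MvPolynomial (Fin N) k))
    (φ : MvPolynomial (Fin N) k ≃ₐ[k] MvPolynomial (Fin N) k)
    (hφ : ∀ n f, f.IsHomogeneous n → (φ f).IsHomogeneous n)
    (e₀ e₁ : Fin N) (hne : e₀ ≠ e₁) (h₀ : φ (X e₀) ∈ p) (h₁ : φ (X e₁) ∈ p) :
    ¬ HasMultiplicity p (N - 2) 2 := by
  intro h
  obtain ⟨d, rfl⟩ : ∃ d, N = d + 2 := ⟨N - 2, by omega⟩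
  have hb := hs_bound p φ hφ e₀ e₁ hne h₀ h₁
  unfold HasMultiplicity at h
  rw [Nat.add_sub_cancel] at h
  have h' := (tendsto_add_atTop_iff_nat 1).2 h
  have hlim : Tendsto (fun n : ℕ => ((1 : ℝ) + d / ((n + 1 : ℕ) : ℝ)) ^ d) atTop (nhds 1) := by
    have h1 : Tendsto (fun n : ℕ => (d : ℝ) / ((n : ℕ) : ℝ)) atTop (nhds 0) :=
      tendsto_const_div_atTop_nhds_zero_nat _
    have h2 := (tendsto_add_atTop_iff_nat 1).2 h1
    have h3 := (h2.const_add 1).pow d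
    simpa using h3
  have hle := le_of_tendsto_of_tendsto' h' hlim (fun n => by
    have hpos : (0 : ℝ) < ((n + 1 : ℕ) : ℝ) := by positivity
    rw [div_le_iff₀ (by positivity), ← mul_pow, add_mul, div_mul_cancel₀ _ hpos.ne', one_mul]
    have h1 : d.factorial * hilbertSamuelFn p (n + 1) ≤ (n + 1 + d) ^ d := by
      refine (Nat.mul_le_mul_left _ (hb n)).trans ?_
      have h2 : (d + 2 - 1 + n - 1).choose n = (d + n).choose d := by
        have : d + 2 - 1 + n - 1 = d + n := by omega
        rw [this]
        exact (Nat.choose_symm_add).symm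
      rw [h2, ← Nat.descFactorial_eq_factorial_mul_choose]
      exact (Nat.descFactorial_le_pow _ _).trans (Nat.pow_le_pow_left (by omega) _)
    exact_mod_cast h1)
  norm_num at hle

lemma cubic_support {k : Type} [Field k] {N : ℕ} (e : Fin 6 → Fin N) (he : Function.Injective e)
    (f : MvPolynomial (Fin N) k) (hf : f.IsHomogeneous 3)
    (h1 : f ∈ Ideal.span (X '' {e 0, e 1} : Set (MvPolynomial (Fin N) k)))
    (h2 : f ∈ Ideal.span (X '' {e 2, e 3} : Set (MvPolynomial (Fin N) k)))
    (h3 : f ∈ Ideal.span (X '' {e 4, e 5} : Set (MvPolynomial (Fin N) k)))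
    (s : Fin N →₀ ℕ) (hs : coeff s f ≠ 0) :
    s.degree = 3 ∧ s (e 0) + s (e 1) = 1 := by
  rw [mem_ideal_span_X_image] at h1 h2 h3
  have hs' := mem_support_iff.2 hs
  have hd : s.degree = 3 := by
    by_contra hc
    exact hs (hf.coeff_eq_zero hc)
  refine ⟨hd, ?_⟩
  have hsum : ∑ j, s (e j) ≤ s.degree := by
    classical
    rw [Finsupp.degree_eq_sum, ← Finset.sum_image (f := fun i => s i) (s := Finset.univ) (g := e)
      (fun a _ b _ h => he h)]
    exact Finset.sum_le_sum_of_subset (Finset.subset_univ _)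
  simp only [Fin.sum_univ_six] at hsum
  have a1 := h1 s hs'
  have a2 := h2 s hs'
  have a3 := h3 s hs'
  simp only [Set.mem_insert_iff, Set.mem_singleton_iff, exists_eq_or_imp, exists_eq_left] at a1 a2 a3
  omega

lemma cubic_decomp {k : Type} [Field k] {N : ℕ} (e : Fin 6 → Fin N) (he : Function.Injective e)
    (f : MvPolynomial (Fin N) k) (hf : f.IsHomogeneous 3)
    (h1 : f ∈ Ideal.span (X '' {e 0, e 1} : Set (MvPolynomial (Fin N) k)))
    (h2 : f ∈ Ideal.span (X '' {e 2, e 3} : Set (MvPolynomial (Fin N) k)))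
    (h3 : f ∈ Ideal.span (X '' {e 4, e 5} : Set (MvPolynomial (Fin N) k))) :
    ∃ α β : MvPolynomial (Fin N) k, α.IsHomogeneous 2 ∧ β.IsHomogeneous 2 ∧
      f = X (e 0) * α + X (e 1) * β ∧ killVars {e 0, e 1} α = α ∧ killVars {e 0, e 1} β = β := by
  classical
  have key := cubic_support e he f hf h1 h2 h3
  have hne : e 0 ≠ e 1 := fun h => absurd (he h) (by decide)
  have aux : ∀ i, i = e 0 ∨ i = e 1 → ∀ s, coeff s (f.divMonomial (Finsupp.single i 1)) ≠ 0 →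
      s.degree = 2 ∧ s (e 0) = 0 ∧ s (e 1) = 0 := by
    intro i hi s hs
    rw [coeff_divMonomial] at hs
    obtain ⟨k1, k2⟩ := key _ hs
    rw [map_add, Finsupp.degree_single] at k1
    simp only [Finsupp.coe_add, Pi.add_apply] at k2
    rcases hi with rfl | rfl
    · simp only [Finsupp.single_eq_same] at k2
      omega
    · simp only [Finsupp.single_eq_same] at k2
      omega
  have hhom : ∀ i, i = e 0 ∨ i = e 1 → (f.divMonomial (Finsupp.single i 1)).IsHomogeneous 2 := by
    intro i hi s hs
    have := (aux i hi s hs).1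
    rw [Finsupp.degree_eq_weight_one] at this
    exact this
  have hkill : ∀ i, i = e 0 ∨ i = e 1 →
      killVars {e 0, e 1} (f.divMonomial (Finsupp.single i 1)) =
        f.divMonomial (Finsupp.single i 1) := by
    intro i hi
    have := hom_congr_vars (f₁ := (killVars (k := k) {e 0, e 1}).toRingHom)
      (f₂ := RingHom.id (MvPolynomial (Fin N) k))
      (p₁ := f.divMonomial (Finsupp.single i 1)) (p₂ := f.divMonomial (Finsupp.single i 1))
      (by ext x; simp) (by
        intro j hj _
        rw [mem_vars] at hj
        obtain ⟨s, hs, hjs⟩ := hj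
        have h4 := aux i hi s (mem_support_iff.1 hs)
        have hj' : j ∉ ({e 0, e 1} : Set (Fin N)) := by
          rintro (rfl | rfl)
          · exact (Finsupp.mem_support_iff.1 hjs) h4.2.1
          · exact (Finsupp.mem_support_iff.1 hjs) h4.2.2
        change killVars {e 0, e 1} (X j) = X j
        unfold killVars
        rw [aeval_X, if_neg hj']) rfl
    exact this
  refine ⟨f.divMonomial (Finsupp.single (e 0) 1), f.divMonomial (Finsupp.single (e 1) 1),
    hhom _ (Or.inl rfl), hhom _ (Or.inr rfl), ?_, hkill _ (Or.inl rfl), hkill _ (Or.inr rfl)⟩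
  have hc : ∀ (i : Fin N) (s : Fin N →₀ ℕ), coeff s (X i * f.divMonomial (Finsupp.single i 1)) =
      if s i = 0 then 0 else coeff s f := by
    intro i s
    rw [coeff_X_mul', coeff_divMonomial]
    by_cases h : s i = 0
    · simp [h]
    · rw [if_pos (Finsupp.mem_support_iff.2 h), if_neg h]
      congr 1
      ext j
      by_cases hj : j = i
      · subst hj; simp; omega
      · simp [Ne.symm hj]
  ext s
  rw [coeff_add, hc, hc]
  by_cases hs : coeff s f = 0
  · simp [hs]
  · have := (key s hs).2
    by_cases h0 : s (e 0) = 0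
    · have h5 : s (e 1) ≠ 0 := by omega
      simp [h0, h5]
    · have h5 : s (e 1) = 0 := by omega
      simp [h0, h5]

lemma isRelPrime_of_height {k : Type} [Field k] {N : ℕ} (f g : MvPolynomial (Fin N) k)
    (h : idealHeight (Ideal.span {f, g}) = 2) : IsRelPrime f g := by
  rw [idealHeight_eq] at h
  intro d hdf hdg
  by_contra hd
  have hle : Ideal.span {f, g} ≤ Ideal.span {d} := by
    rw [Ideal.span_le]
    rintro x (rfl | rfl)
    · exact Ideal.mem_span_singleton.2 hdf
    · exact Ideal.mem_span_singleton.2 hdg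
  have h1 := (Ideal.height_mono hle).trans (Ideal.height_span_singleton_le_one hd)
  rw [h] at h1
  exact absurd h1 (by decide)

lemma eq_zero_of_cubic_dvd {k : Type} [Field k] {N : ℕ} (f α : MvPolynomial (Fin N) k)
    (hf : f.IsHomogeneous 3) (hα : α.IsHomogeneous 2) (h : f ∣ α) : α = 0 := by
  by_contra hα0
  obtain ⟨q, rfl⟩ := h
  have hf0 : f ≠ 0 := left_ne_zero_of_mul hα0
  have hq0 : q ≠ 0 := right_ne_zero_of_mul hα0
  have h1 := hα.totalDegree hα0
  rw [totalDegree_mul_of_isDomain hf0 hq0, hf.totalDegree hf0] at h1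
  omega

/-- The core argument: two coprime cubics in `K₁ ∩ p₂ ∩ p₃` force `p₁ ≤ K₁`. -/
lemma core {k : Type} [Field k] {N : ℕ} (e : Fin 6 → Fin N) (he : Function.Injective e)
    (f g : MvPolynomial (Fin N) k) (hf : f.IsHomogeneous 3) (hg : g.IsHomogeneous 3)
    (hrel : IsRelPrime f g) (K : Ideal (MvPolynomial (Fin N) k)) (hK : K.IsPrimary)
    (hrad : K.radical = Ideal.span (X '' {e 0, e 1} : Set (MvPolynomial (Fin N) k)))
    (hfK : f ∈ K) (hgK : g ∈ K)
    (hf2 : f ∈ Ideal.span (X '' {e 2, e 3} : Set (MvPolynomial (Fin N) k)))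
    (hf3 : f ∈ Ideal.span (X '' {e 4, e 5} : Set (MvPolynomial (Fin N) k)))
    (hg2 : g ∈ Ideal.span (X '' {e 2, e 3} : Set (MvPolynomial (Fin N) k)))
    (hg3 : g ∈ Ideal.span (X '' {e 4, e 5} : Set (MvPolynomial (Fin N) k))) :
    X (e 0) ∈ K ∧ X (e 1) ∈ K := by
  obtain ⟨α, β, hα, hβ, hfe, kα, kβ⟩ := cubic_decomp e he f hf
    (hrad ▸ Ideal.le_radical hfK) hf2 hf3
  obtain ⟨γ, δ, hγ, hδ, hge, kγ, kδ⟩ := cubic_decomp e he g hg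
    (hrad ▸ Ideal.le_radical hgK) hg2 hg3
  by_cases hD : α * δ - γ * β ∈ Ideal.span (X '' {e 0, e 1} : Set (MvPolynomial (Fin N) k))
  · exfalso
    have hD0 : α * δ - γ * β = 0 := by
      rw [span_X_image_eq_ker] at hD
      have h1 : killVars {e 0, e 1} (α * δ - γ * β) = 0 := hD
      rwa [map_sub, map_mul, map_mul, kα, kβ, kγ, kδ] at h1
    have hα0 : α = 0 := by
      apply eq_zero_of_cubic_dvd f α hf hα
      apply hrel.dvd_of_dvd_mul_right
      refine ⟨γ, ?_⟩
      rw [hfe, hge]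
      linear_combination X (e 1) * hD0
    have hβ0 : β = 0 := by
      apply eq_zero_of_cubic_dvd f β hf hβ
      apply hrel.dvd_of_dvd_mul_right
      refine ⟨δ, ?_⟩
      rw [hfe, hge]
      linear_combination (- X (e 0)) * hD0
    have hf0 : f = 0 := by rw [hfe, hα0, hβ0]; simp
    have hgu : IsUnit g := hrel (hf0 ▸ dvd_zero g) dvd_rfl
    have : (⊤ : Ideal (MvPolynomial (Fin N) k)) ≤ K := by
      rw [Ideal.eq_top_of_isUnit_mem K hgK hgu]
    exact hK.1 (top_le_iff.1 this)
  · rw [← hrad] at hD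
    rw [Ideal.isPrimary_iff] at hK
    constructor
    · refine (hK.2 (x := X (e 0)) (y := α * δ - γ * β) ?_).resolve_right hD
      have : X (e 0) * (α * δ - γ * β) = δ * f - β * g := by
        rw [hfe, hge]; ring
      rw [this]
      exact K.sub_mem (K.mul_mem_left _ hfK) (K.mul_mem_left _ hgK)
    · refine (hK.2 (x := X (e 1)) (y := α * δ - γ * β) ?_).resolve_right hD
      have : X (e 1) * (α * δ - γ * β) = α * g - γ * f := by
        rw [hfe, hge]; ring
      rw [this]
      exact K.sub_mem (K.mul_mem_left _ hgK) (K.mul_mem_left _ hfK)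

lemma le_unmixedPart {R : Type} [CommRing R] (J : Ideal R) : J ≤ unmixedPart J := by
  unfold unmixedPart
  refine le_iInf₂ fun p hp => ?_
  have h1 : (1 : R) ∉ p := fun h => hp.1.ne_top ((Ideal.eq_top_iff_one p).2 h)
  refine le_trans ?_ (le_iSup₂ (f := fun (s : R) (_ : s ∉ p) =>
    Submodule.colon J (Ideal.span {s})) 1 h1)
  intro x hx
  rw [Submodule.mem_colon]
  intro y _
  exact J.mul_mem_right _ hx

end Helpers

theorem statement_17
    {k : Type} [Field k] [IsAlgClosed k] {N : ℕ}
    (f₁ f₂ f₃ : MvPolynomial (Fin N) k)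
    (hf₁ : f₁.IsHomogeneous 3) (hf₂ : f₂.IsHomogeneous 3) (hf₃ : f₃.IsHomogeneous 3)
    (hIht : idealHeight (Ideal.span {f₁, f₂, f₃}) = 2)
    (hht₁₂ : idealHeight (Ideal.span {f₁, f₂}) = 2)
    (hht₁₃ : idealHeight (Ideal.span {f₁, f₃}) = 2)
    (hht₂₃ : idealHeight (Ideal.span {f₂, f₃}) = 2)
    (p₁ p₂ p₃ : Ideal (MvPolynomial (Fin N) k))
    (hp₁ : IsLinearPrime p₁) (hp₂ : IsLinearPrime p₂) (hp₃ : IsLinearPrime p₃)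
    (hpht₁ : idealHeight p₁ = 2) (hpht₂ : idealHeight p₂ = 2) (hpht₃ : idealHeight p₃ = 2)
    (hne₁₂ : p₁ ≠ p₂) (hne₁₃ : p₁ ≠ p₃) (hne₂₃ : p₂ ≠ p₃)
    (K₁ : Ideal (MvPolynomial (Fin N) k))
    (hK₁primary : K₁.IsPrimary) (hK₁rad : K₁.radical = p₁)
    (hK₁e : HasMultiplicity K₁ (N - 2) 2)
    (hK : K₁ ⊓ p₂ ⊓ p₃ = unmixedPart (Ideal.span {f₁, f₂, f₃}) ∨ K₁ ⊓ p₂ ⊓ p₃ = Submodule.colon (Ideal.span {f₁, f₂}) (Ideal.span {f₃})) :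
    idealHeight (p₁ ⊔ p₂ ⊔ p₃) ≤ 5 := by
  have hmemI : f₁ ∈ K₁ ⊓ p₂ ⊓ p₃ ∧ f₂ ∈ K₁ ⊓ p₂ ⊓ p₃ := by
    rcases hK with hK | hK
    · rw [hK]
      exact ⟨le_unmixedPart _ (Ideal.subset_span (by simp)),
        le_unmixedPart _ (Ideal.subset_span (by simp))⟩
    · rw [hK]
      constructor <;>
      · rw [Submodule.mem_colon]
        intro y _
        exact Ideal.mul_mem_right _ _ (Ideal.subset_span (by simp))
  obtain ⟨⟨⟨hfK, hf2⟩, hf3⟩, ⟨⟨hgK, hg2⟩, hg3⟩⟩ := hmemI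
  by_contra hcon
  obtain ⟨a₁, b₁, ha₁, hb₁, hpe₁⟩ := linear_prime_gens p₁ hp₁ hpht₁
  obtain ⟨a₂, b₂, ha₂, hb₂, hpe₂⟩ := linear_prime_gens p₂ hp₂ hpht₂
  obtain ⟨a₃, b₃, ha₃, hb₃, hpe₃⟩ := linear_prime_gens p₃ hp₃ hpht₃
  let l : Fin 6 → MvPolynomial (Fin N) k := ![a₁, b₁, a₂, b₂, a₃, b₃]
  have hl : ∀ i, (l i).IsHomogeneous 1 := by
    intro i
    fin_cases i
    exacts [ha₁, hb₁, ha₂, hb₂, ha₃, hb₃]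
  have hsup : p₁ ⊔ p₂ ⊔ p₃ = Ideal.span (Set.range l) := by
    rw [hpe₁, hpe₂, hpe₃, ← Ideal.span_union, ← Ideal.span_union]
    congr 1
    ext x
    simp [l, eq_comm]
    tauto
  rw [hsup] at hcon
  obtain ⟨φ, e, he, hφl, hφ, hφs⟩ := exists_linear_equiv l hl (six_forms l hl hcon)
  have hcomap : ∀ (p : Ideal (MvPolynomial (Fin N) k)) (i j : Fin 6),
      p = Ideal.span {l i, l j} → ∀ x, x ∈ p ↔
        φ.symm x ∈ Ideal.span (X '' {e i, e j} : Set (MvPolynomial (Fin N) k)) := by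
    intro p i j hp x
    have h1 : p = (Ideal.span (X '' {e i, e j} : Set (MvPolynomial (Fin N) k))).map φ := by
      rw [Ideal.map_span, hp, ← hφl i, ← hφl j, Set.image_image, Set.image_pair]
    constructor
    · intro hx
      rw [h1] at hx
      obtain ⟨y, hy, rfl⟩ := (Ideal.mem_map_of_equiv φ x).1 hx
      rwa [AlgEquiv.symm_apply_apply]
    · intro hx
      rw [h1]
      exact (Ideal.mem_map_of_equiv φ x).2 ⟨_, hx, AlgEquiv.apply_symm_apply _ _⟩
  have hm₁ := hcomap p₁ 0 1 hpe₁
  have hm₂ := hcomap p₂ 2 3 hpe₂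
  have hm₃ := hcomap p₃ 4 5 hpe₃
  have hrel := isRelPrime_of_height f₁ f₂ hht₁₂
  have hrel' : IsRelPrime (φ.symm f₁) (φ.symm f₂) := by
    intro d hd1 hd2
    have h1 : φ d ∣ f₁ := by simpa using map_dvd φ hd1
    have h2 : φ d ∣ f₂ := by simpa using map_dvd φ hd2
    simpa using (hrel h1 h2).map φ.symm
  have hcore := core e he (φ.symm f₁) (φ.symm f₂) (hφs _ _ hf₁) (hφs _ _ hf₂) hrel'
    (K₁.comap φ) (hK₁primary.comap (φ : MvPolynomial (Fin N) k →+* MvPolynomial (Fin N) k))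
    (by
      rw [← Ideal.comap_radical, hK₁rad]
      ext x
      rw [Ideal.mem_comap, hm₁, AlgEquiv.symm_apply_apply])
    (by simpa using hfK) (by simpa using hgK)
    ((hm₂ _).1 hf2) ((hm₃ _).1 hf3) ((hm₂ _).1 hg2) ((hm₃ _).1 hg3)
  have hne : e 0 ≠ e 1 := fun h => absurd (he h) (by decide)
  have hN : 2 ≤ N := by
    have := Fintype.card_le_of_injective e he
    simp at this
    omega
  exact not_mult_two hN K₁ φ hφ (e 0) (e 1) hne hcore.1 hcore.2 hK₁e

end
end

section
/- Let p1, p2, p3 be three distinct linear primes of height 2 in a polynomial ring R over a field, with ht(p1 + p2 + p3) ≥ 5. If ht(pi + pj) = 4 for all i ≠ j, then p1 ∩ p2 ∩ p3 = p1 · p2 · p3. -/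
open MvPolynomial Filter CategoryTheory

noncomputable section

/-- The ideal generated by a subspace. -/
abbrev linIdeal {k : Type} [Field k] {N : ℕ} (V : Submodule k (MvPolynomial (Fin N) k)) :
    Ideal (MvPolynomial (Fin N) k) := Ideal.span (V : Set (MvPolynomial (Fin N) k))

section Helpers

variable {k : Type} [Field k] {N : ℕ}

theorem linIdeal_ker (V : Submodule k (MvPolynomial (Fin N) k))
    (hV : V ≤ homogeneousSubmodule (Fin N) k 1) :
    ∃ φ : MvPolynomial (Fin N) k →ₐ[k] MvPolynomial (Fin N) k,
      RingHom.ker φ = linIdeal V ∧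
      ∀ x ∈ homogeneousSubmodule (Fin N) k 1, φ x = 0 → x ∈ V := by
  obtain ⟨C, hC⟩ := Submodule.exists_isCompl V
  set π := C.projection V hC.symm with hπ
  let φ : MvPolynomial (Fin N) k →ₐ[k] MvPolynomial (Fin N) k := aeval (fun i => π (X i))
  have hφ : ∀ x ∈ homogeneousSubmodule (Fin N) k 1, φ x = π x := by
    intro x hx
    rw [homogeneousSubmodule_one_eq_span_X] at hx
    induction hx using Submodule.span_induction with
    | mem x h => obtain ⟨i, rfl⟩ := h; simp [φ]
    | zero => simp
    | add x y _ _ hx hy => simp [hx, hy]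
    | smul a x _ hx => simp [hx]
  refine ⟨φ, le_antisymm ?_ ?_, ?_⟩
  · intro f hf
    have key : (Ideal.Quotient.mkₐ k (linIdeal V)).comp φ = Ideal.Quotient.mkₐ k (linIdeal V) := by
      ext i
      simp only [AlgHom.comp_apply, Ideal.Quotient.mkₐ_eq_mk, φ, aeval_X]
      rw [eq_comm, Ideal.Quotient.eq]
      exact Ideal.subset_span (Submodule.sub_projection_mem hC.symm (X i))
    have h2 := DFunLike.congr_fun key f
    rw [AlgHom.comp_apply, show φ f = 0 from hf, map_zero] at h2
    exact Ideal.Quotient.eq_zero_iff_mem.1 h2.symm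
  · rw [Ideal.span_le]
    intro v hv
    show φ v = 0
    rw [hφ v (hV hv)]
    exact (Submodule.projection_apply_eq_zero_iff hC.symm).2 hv
  · intro x hx h
    rw [hφ x hx] at h
    exact (Submodule.projection_apply_eq_zero_iff hC.symm).1 h

theorem linIdeal_prime {V : Submodule k (MvPolynomial (Fin N) k)}
    (hV : V ≤ homogeneousSubmodule (Fin N) k 1) : (linIdeal V).IsPrime := by
  obtain ⟨φ, h, -⟩ := linIdeal_ker V hV
  rw [← h]
  exact RingHom.ker_isPrime _

theorem mem_of_mem_linIdeal {V : Submodule k (MvPolynomial (Fin N) k)}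
    (hV : V ≤ homogeneousSubmodule (Fin N) k 1) {x : MvPolynomial (Fin N) k}
    (hx : x ∈ homogeneousSubmodule (Fin N) k 1) (h : x ∈ linIdeal V) : x ∈ V := by
  obtain ⟨φ, h1, h2⟩ := linIdeal_ker V hV
  rw [← h1] at h
  exact h2 x hx h

theorem linIdeal_span (S : Set (MvPolynomial (Fin N) k)) :
    linIdeal (Submodule.span k S) = Ideal.span S := by
  apply le_antisymm
  · rw [Ideal.span_le]
    exact Submodule.span_le_restrictScalars k (MvPolynomial (Fin N) k) S
  · exact Ideal.span_mono Submodule.subset_span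

theorem linIdeal_sup (V W : Submodule k (MvPolynomial (Fin N) k)) :
    linIdeal (V ⊔ W) = linIdeal V ⊔ linIdeal W := by
  have h : V ⊔ W = Submodule.span k ((V : Set (MvPolynomial (Fin N) k)) ∪ W) := by
    rw [Submodule.span_union, Submodule.span_eq, Submodule.span_eq]
  rw [h, linIdeal_span, Ideal.span_union]

theorem finite_of_le {V : Submodule k (MvPolynomial (Fin N) k)}
    (hV : V ≤ homogeneousSubmodule (Fin N) k 1) : FiniteDimensional k V := by
  have : FiniteDimensional k (homogeneousSubmodule (Fin N) k 1) := by
    rw [homogeneousSubmodule_one_eq_span_X]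
    exact FiniteDimensional.span_of_finite k (Set.finite_range _)
  exact Submodule.finiteDimensional_of_le hV

theorem idealHeight_prime {R : Type} [CommRing R] (p : Ideal R) (hp : p.IsPrime) :
    idealHeight p = p.height := by
  have h1 : idealHeight p = Order.height (⟨p, hp⟩ : {q : Ideal R // q.IsPrime}) := by
    apply le_antisymm
    · exact iInf₂_le (⟨p, hp⟩ : {q : Ideal R // q.IsPrime}) (le_refl p)
    · exact le_iInf₂ fun q hq => Order.height_mono hq
  let f : PrimeSpectrum R ≃o {q : Ideal R // q.IsPrime} :=
    { toFun := fun q => ⟨q.asIdeal, q.2⟩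
      invFun := fun q => ⟨q.1, q.2⟩
      left_inv := fun _ => rfl
      right_inv := fun _ => rfl
      map_rel_iff' := Iff.rfl }
  rw [h1]
  exact (Order.height_orderIso f ⟨p, hp⟩).trans (PrimeSpectrum.height_eq_orderHeight ⟨p, hp⟩).symm

theorem le_height_linIdeal (n : ℕ) : ∀ (V : Submodule k (MvPolynomial (Fin N) k))
    (_ : V ≤ homogeneousSubmodule (Fin N) k 1) (_ : n ≤ Module.finrank k V),
    (n : ℕ∞) ≤ (linIdeal V).height := by
  induction n with
  | zero => intros; simp
  | succ n ih =>
    intro V hV hn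
    have := finite_of_le hV
    obtain ⟨v, hv⟩ := exists_linearIndependent_of_le_finrank (R := k) (M := V) (n := n) (by omega)
    let U := (Submodule.span k (Set.range v)).map V.subtype
    have hUV : U ≤ V := Submodule.map_subtype_le V _
    have hUn : Module.finrank k U = n := by
      rw [Submodule.finrank_map_subtype_eq, finrank_span_eq_card hv, Fintype.card_fin]
    have hU := hUV.trans hV
    have hUI := linIdeal_prime hU
    have hVI := linIdeal_prime hV
    have hlt : linIdeal U < linIdeal V := by
      refine lt_of_le_of_ne (Ideal.span_mono hUV) fun he => ?_
      have hVU : V ≤ U := fun x hx =>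
        mem_of_mem_linIdeal hU (hV hx) (he ▸ Ideal.subset_span hx)
      have : V = U := le_antisymm hVU hUV
      rw [this] at hn
      omega
    have h1 := Ideal.height_add_one_le_of_lt_of_isPrime hlt
    push_cast
    exact (add_le_add_left (ih U hU hUn.ge) 1).trans h1

theorem height_linIdeal {V : Submodule k (MvPolynomial (Fin N) k)}
    (hV : V ≤ homogeneousSubmodule (Fin N) k 1) :
    idealHeight (linIdeal V) = Module.finrank k V := by
  have hp := linIdeal_prime hV
  have := finite_of_le hV
  rw [idealHeight_prime _ hp]
  apply le_antisymm _ (le_height_linIdeal _ V hV le_rfl)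
  let b := Module.finBasis k V
  have hs : linIdeal V = Ideal.span (Set.range fun i => (b i : MvPolynomial (Fin N) k)) := by
    rw [← linIdeal_span]
    have := congrArg (Submodule.map V.subtype) b.span_eq
    rw [Submodule.map_span, Submodule.map_top, Submodule.range_subtype, ← Set.range_comp] at this
    exact congrArg linIdeal this.symm
  refine (Ideal.height_le_spanFinrank _ hp.ne_top).trans ?_
  rw [hs, Ideal.span]
  refine Nat.cast_le.2 ((Submodule.spanFinrank_span_le_ncard_of_finite (Set.finite_range _)).trans ?_)
  rw [← Set.image_univ]
  refine (Set.ncard_image_le Set.finite_univ).trans ?_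
  simp

/-- If `a`, `b` is a regular sequence modulo `Q`, then `(a, b) ∩ Q = (a, b) Q`. -/
theorem inf_le_mul_of_regular {R : Type} [CommRing R] (Q : Ideal R) (a b : R)
    (ha : ∀ x, a * x ∈ Q → x ∈ Q)
    (hb : ∀ x, b * x ∈ Q ⊔ Ideal.span {a} → x ∈ Q ⊔ Ideal.span {a}) :
    Ideal.span {a, b} ⊓ Q ≤ Ideal.span {a, b} * Q := by
  rintro f ⟨hf, hfQ⟩
  obtain ⟨x, y, rfl⟩ := Ideal.mem_span_pair.1 hf
  have h1 : b * y ∈ Q ⊔ Ideal.span {a} := by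
    have : b * y = (x * a + y * b) - x * a := by ring
    rw [this]
    exact Ideal.sub_mem _ (Ideal.mem_sup_left hfQ)
      (Ideal.mem_sup_right (Ideal.mul_mem_left _ _ (Ideal.mem_span_singleton_self a)))
  obtain ⟨v, hv, w, hw, hvw⟩ := Submodule.mem_sup.1 (hb y h1)
  obtain ⟨u, rfl⟩ := Ideal.mem_span_singleton.1 hw
  have h2 : x + u * b ∈ Q := by
    apply ha
    have : a * (x + u * b) = (x * a + y * b) - b * v := by rw [← hvw]; ring
    rw [this]
    exact Ideal.sub_mem _ hfQ (Ideal.mul_mem_left _ _ hv)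
  have h3 : x * a + y * b = a * (x + u * b) + b * v := by rw [← hvw]; ring
  rw [h3]
  exact Ideal.add_mem _ (Ideal.mul_mem_mul (Ideal.subset_span (by simp)) h2)
    (Ideal.mul_mem_mul (Ideal.subset_span (by simp)) hv)

theorem exists_pair {V : Submodule k (MvPolynomial (Fin N) k)} (h : Module.finrank k V = 2)
    {a : MvPolynomial (Fin N) k} (ha : a ∈ V) (ha0 : a ≠ 0) :
    ∃ b, V = Submodule.span k {a, b} ∧ ∀ t : k, b - t • a ≠ 0 := by
  have hfin : FiniteDimensional k V := FiniteDimensional.of_finrank_pos (by omega)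
  have hle : Submodule.span k {a} ≤ V := by simpa using ha
  have h1 : Module.finrank k (Submodule.span k {a}) = 1 := finrank_span_singleton ha0
  obtain ⟨b, hbV, hb⟩ : ∃ b ∈ V, b ∉ Submodule.span k {a} := by
    by_contra! hcon
    have : V = Submodule.span k {a} := le_antisymm hcon hle
    rw [this] at h
    omega
  have hb' : ∀ t : k, b - t • a ≠ 0 := by
    intro t ht
    exact hb (Submodule.mem_span_singleton.2 ⟨t, (sub_eq_zero.1 ht).symm⟩)
  refine ⟨b, ?_, hb'⟩
  have hle2 : Submodule.span k {a, b} ≤ V := by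
    rw [Submodule.span_le]
    rintro x (rfl | rfl) <;> assumption
  have hfin2 : FiniteDimensional k (Submodule.span k {a, b}) :=
    Submodule.finiteDimensional_of_le hle2
  have hlt : Submodule.span k {a} < Submodule.span k {a, b} :=
    lt_of_le_of_ne (Submodule.span_mono (by simp)) fun he =>
      hb (he ▸ Submodule.subset_span (by simp))
  have := Submodule.finrank_lt_finrank_of_lt hlt
  exact (Submodule.eq_of_le_of_finrank_le hle2 (by omega)).symm

theorem notMem_sup_singleton {V U : Submodule k (MvPolynomial (Fin N) k)} (hd : V ⊓ U = ⊥)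
    {a b : MvPolynomial (Fin N) k} (ha : a ∈ V) (hb : b ∈ V) (hab : ∀ t : k, b - t • a ≠ 0) :
    b ∉ U ⊔ Submodule.span k {a} := by
  intro h
  obtain ⟨u, hu, w, hw, rfl⟩ := Submodule.mem_sup.1 h
  obtain ⟨t, rfl⟩ := Submodule.mem_span_singleton.1 hw
  apply hab t
  have : u + t • a - t • a ∈ V ⊓ U :=
    ⟨V.sub_mem hb (V.smul_mem t ha), by simpa using hu⟩
  rwa [hd, Submodule.mem_bot] at this

theorem linIdeal_inf_le {V U : Submodule k (MvPolynomial (Fin N) k)}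
    (hV : V ≤ homogeneousSubmodule (Fin N) k 1) (hU : U ≤ homogeneousSubmodule (Fin N) k 1)
    (h2 : Module.finrank k V = 2) (hd : V ⊓ U = ⊥) :
    linIdeal V ⊓ linIdeal U ≤ linIdeal V * linIdeal U := by
  have hne : V ≠ ⊥ := by rintro rfl; simp at h2
  obtain ⟨a, ha, ha0⟩ := V.ne_bot_iff.1 hne
  obtain ⟨b, hVs, hb⟩ := exists_pair h2 ha ha0
  have hbV : b ∈ V := by rw [hVs]; exact Submodule.subset_span (by simp)
  have hVI : linIdeal V = Ideal.span {a, b} := by rw [hVs, linIdeal_span]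
  have hUa : U ⊔ Submodule.span k {a} ≤ homogeneousSubmodule (Fin N) k 1 :=
    sup_le hU (by simpa using hV ha)
  have hUaI : linIdeal U ⊔ Ideal.span {a} = linIdeal (U ⊔ Submodule.span k {a}) := by
    rw [linIdeal_sup, linIdeal_span {a}]
  rw [hVI]
  apply inf_le_mul_of_regular
  · intro x hx
    refine ((linIdeal_prime hU).mem_or_mem hx).resolve_left fun h => ha0 ?_
    have : a ∈ V ⊓ U := ⟨ha, mem_of_mem_linIdeal hU (hV ha) h⟩
    rwa [hd, Submodule.mem_bot] at this
  · intro x hx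
    rw [hUaI] at hx ⊢
    refine ((linIdeal_prime hUa).mem_or_mem hx).resolve_left fun h => ?_
    exact notMem_sup_singleton hd ha hbV hb (mem_of_mem_linIdeal hUa (hV hbV) h)

theorem linear_main {V₁ V₂ V₃ : Submodule k (MvPolynomial (Fin N) k)}
    (h₁ : V₁ ≤ homogeneousSubmodule (Fin N) k 1) (h₂ : V₂ ≤ homogeneousSubmodule (Fin N) k 1)
    (h₃ : V₃ ≤ homogeneousSubmodule (Fin N) k 1)
    (r₁ : Module.finrank k V₁ = 2) (r₃ : Module.finrank k V₃ = 2)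
    (d₁₂ : V₁ ⊓ V₂ = ⊥) (d₁₃ : V₃ ⊓ V₁ = ⊥) (d₂₃ : V₃ ⊓ V₂ = ⊥)
    (hn : ¬ V₃ ≤ V₁ ⊔ V₂) :
    linIdeal V₁ ⊓ linIdeal V₂ ⊓ linIdeal V₃ ≤ linIdeal V₁ * linIdeal V₂ * linIdeal V₃ := by
  obtain ⟨e, heV, he⟩ := Set.not_subset.1 hn
  have he0 : e ≠ 0 := by rintro rfl; exact he (Submodule.zero_mem _)
  have he₁ : e ∉ V₁ := fun h => he (Submodule.mem_sup_left h)
  have he₂ : e ∉ V₂ := fun h => he (Submodule.mem_sup_right h)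
  obtain ⟨c, hV₃, hc⟩ := exists_pair r₃ heV he0
  have hcV : c ∈ V₃ := by rw [hV₃]; exact Submodule.subset_span (by simp)
  have hI₃ : linIdeal V₃ = Ideal.span {e, c} := by rw [hV₃, linIdeal_span]
  have hle : Submodule.span k {e} ≤ homogeneousSubmodule (Fin N) k 1 := by simpa using h₃ heV
  have h₁e := sup_le h₁ hle
  have h₂e := sup_le h₂ hle
  have hd : V₁ ⊓ (V₂ ⊔ Submodule.span k {e}) = ⊥ := by
    rw [eq_bot_iff]
    rintro x ⟨hx1, hx2⟩
    obtain ⟨v, hv, w, hw, rfl⟩ := Submodule.mem_sup.1 hx2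
    obtain ⟨t, rfl⟩ := Submodule.mem_span_singleton.1 hw
    by_cases ht : t = 0
    · subst ht
      rw [← d₁₂]
      refine ⟨hx1, by simpa using hv⟩
    · exfalso
      apply he
      have : e = t⁻¹ • ((v + t • e) - v) := by simp [smul_smul, ht]
      rw [this]
      exact Submodule.smul_mem _ _ (Submodule.sub_mem _ (Submodule.mem_sup_left hx1)
        (Submodule.mem_sup_right hv))
  have hA := linIdeal_inf_le h₁ h₂ r₁ d₁₂
  have hB := linIdeal_inf_le h₁ h₂e r₁ hd
  have hI₁e : linIdeal (V₁ ⊔ Submodule.span k {e}) = linIdeal V₁ ⊔ Ideal.span {e} := by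
    rw [linIdeal_sup, linIdeal_span {e}]
  have hI₂e : linIdeal (V₂ ⊔ Submodule.span k {e}) = linIdeal V₂ ⊔ Ideal.span {e} := by
    rw [linIdeal_sup, linIdeal_span {e}]
  have hQe : linIdeal V₁ ⊓ linIdeal V₂ ⊔ Ideal.span {e} =
      linIdeal (V₁ ⊔ Submodule.span k {e}) ⊓ linIdeal (V₂ ⊔ Submodule.span k {e}) := by
    rw [hI₁e, hI₂e]
    rw [hI₂e] at hB
    apply le_antisymm
    · exact sup_le (inf_le_inf le_sup_left le_sup_left) (le_inf le_sup_right le_sup_right)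
    · rintro f ⟨hf1, hf2⟩
      obtain ⟨g, hg, w, hw, rfl⟩ := Submodule.mem_sup.1 hf1
      have hg2 : g ∈ linIdeal V₂ ⊔ Ideal.span {e} := by
        have : g = g + w - w := by ring
        rw [this]
        exact Ideal.sub_mem _ hf2 (Ideal.mem_sup_right hw)
      refine Ideal.add_mem _ ?_ (Ideal.mem_sup_right hw)
      have hg3 := hB ⟨hg, hg2⟩
      rw [Ideal.mul_sup] at hg3
      have hle3 : linIdeal V₁ * linIdeal V₂ ⊔ linIdeal V₁ * Ideal.span {e} ≤
          linIdeal V₁ ⊓ linIdeal V₂ ⊔ Ideal.span {e} :=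
        sup_le_sup Ideal.mul_le_inf Ideal.mul_le_right
      exact hle3 hg3
  have hfin := inf_le_mul_of_regular (linIdeal V₁ ⊓ linIdeal V₂) e c ?_ ?_
  · rw [← hI₃] at hfin
    calc linIdeal V₁ ⊓ linIdeal V₂ ⊓ linIdeal V₃
        = linIdeal V₃ ⊓ (linIdeal V₁ ⊓ linIdeal V₂) := inf_comm _ _
      _ ≤ linIdeal V₃ * (linIdeal V₁ ⊓ linIdeal V₂) := hfin
      _ ≤ linIdeal V₃ * (linIdeal V₁ * linIdeal V₂) := Ideal.mul_mono_right hA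
      _ = _ := mul_comm _ _
  · rintro x ⟨hx1, hx2⟩
    exact ⟨((linIdeal_prime h₁).mem_or_mem hx1).resolve_left fun h =>
        he₁ (mem_of_mem_linIdeal h₁ (h₃ heV) h),
      ((linIdeal_prime h₂).mem_or_mem hx2).resolve_left fun h =>
        he₂ (mem_of_mem_linIdeal h₂ (h₃ heV) h)⟩
  · intro x hx
    rw [hQe] at hx ⊢
    exact ⟨((linIdeal_prime h₁e).mem_or_mem hx.1).resolve_left fun h =>
        notMem_sup_singleton d₁₃ heV hcV hc (mem_of_mem_linIdeal h₁e (h₃ hcV) h),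
      ((linIdeal_prime h₂e).mem_or_mem hx.2).resolve_left fun h =>
        notMem_sup_singleton d₂₃ heV hcV hc (mem_of_mem_linIdeal h₂e (h₃ hcV) h)⟩

theorem IsLinearPrime.exists_eq {p : Ideal (MvPolynomial (Fin N) k)} (hp : IsLinearPrime p) :
    ∃ V : Submodule k (MvPolynomial (Fin N) k),
      V ≤ homogeneousSubmodule (Fin N) k 1 ∧ p = linIdeal V := by
  obtain ⟨-, S, hS, rfl⟩ := hp
  exact ⟨Submodule.span k S, Submodule.span_le.2 hS, (linIdeal_span S).symm⟩

theorem inf_eq_bot_of_height {V W : Submodule k (MvPolynomial (Fin N) k)}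
    (hV : V ≤ homogeneousSubmodule (Fin N) k 1) (hW : W ≤ homogeneousSubmodule (Fin N) k 1)
    (rV : Module.finrank k V = 2) (rW : Module.finrank k W = 2)
    (h : idealHeight (linIdeal V ⊔ linIdeal W) = 4) : V ⊓ W = ⊥ := by
  rw [← linIdeal_sup, height_linIdeal (sup_le hV hW)] at h
  have h' : Module.finrank k ↥(V ⊔ W) = 4 := by exact_mod_cast h
  have := finite_of_le hV
  have := finite_of_le hW
  have := Submodule.finrank_sup_add_finrank_inf_eq V W
  rw [← Submodule.finrank_eq_zero (R := k)]
  omega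

end Helpers

theorem statement_18 {k : Type} [Field k] {N : ℕ}
    (p₁ p₂ p₃ : Ideal (MvPolynomial (Fin N) k))
    (hp₁ : IsLinearPrime p₁) (hp₂ : IsLinearPrime p₂) (hp₃ : IsLinearPrime p₃)
    (hpht₁ : idealHeight p₁ = 2) (hpht₂ : idealHeight p₂ = 2) (hpht₃ : idealHeight p₃ = 2)
    (hne₁₂ : p₁ ≠ p₂) (hne₁₃ : p₁ ≠ p₃) (hne₂₃ : p₂ ≠ p₃)
    (hsum : 5 ≤ idealHeight (p₁ ⊔ p₂ ⊔ p₃))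
    (hht₁₂ : idealHeight (p₁ ⊔ p₂) = 4)
    (hht₁₃ : idealHeight (p₁ ⊔ p₃) = 4)
    (hht₂₃ : idealHeight (p₂ ⊔ p₃) = 4) :
    p₁ ⊓ p₂ ⊓ p₃ = p₁ * p₂ * p₃ := by
  obtain ⟨V₁, h₁, rfl⟩ := hp₁.exists_eq
  obtain ⟨V₂, h₂, rfl⟩ := hp₂.exists_eq
  obtain ⟨V₃, h₃, rfl⟩ := hp₃.exists_eq
  rw [height_linIdeal h₁] at hpht₁
  rw [height_linIdeal h₂] at hpht₂
  rw [height_linIdeal h₃] at hpht₃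
  have r₁ : Module.finrank k V₁ = 2 := by exact_mod_cast hpht₁
  have r₂ : Module.finrank k V₂ = 2 := by exact_mod_cast hpht₂
  have r₃ : Module.finrank k V₃ = 2 := by exact_mod_cast hpht₃
  have d₁₂ := inf_eq_bot_of_height h₁ h₂ r₁ r₂ hht₁₂
  have d₁₃ := inf_eq_bot_of_height h₁ h₃ r₁ r₃ hht₁₃
  have d₂₃ := inf_eq_bot_of_height h₂ h₃ r₂ r₃ hht₂₃
  apply le_antisymm
  · refine linear_main h₁ h₂ h₃ r₁ r₃ d₁₂ (inf_comm V₁ V₃ ▸ d₁₃) (inf_comm V₂ V₃ ▸ d₂₃) ?_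
    intro hle
    have h : linIdeal V₁ ⊔ linIdeal V₂ ⊔ linIdeal V₃ = linIdeal V₁ ⊔ linIdeal V₂ := by
      rw [← linIdeal_sup, sup_eq_left]
      exact Ideal.span_mono hle
    rw [h, hht₁₂] at hsum
    exact absurd hsum (by decide)
  · exact Ideal.mul_le_inf.trans (inf_le_inf_right _ Ideal.mul_le_inf)

end
end
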